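/- The silo process W_t on [0,∞)^{Λ^N} has at most one invariant probability measure: if μ and ν are both invariant probability measures for the silo process, then μ = ν. -/

import Mathlib

open MeasureTheory ProbabilityTheory Filter

noncomputable section

/-- The uniform distribution on `[0,1]`. -/
def unif01 : Measure ℝ := volume.restrict (Set.Icc (0:ℝ) 1)

/-- Truncation of a configuration to the box `Λ^N = {1,…,N}` (zero outside). -/
def trunc (N : ℕ) (w : ℤ → ℝ) : ℤ → ℝ :=
  fun i => if 1 ≤ i ∧ i ≤ (N : ℤ) then w i else 0

/-- One step of the width-`N` silo dynamics with fractions `u` and added weights `v`. -/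
def siloStep (N : ℕ) (u v w : ℤ → ℝ) : ℤ → ℝ :=
  trunc N fun i => v i + trunc N w (i + 1) * u (i + 1) + trunc N w (i - 1) * (1 - u (i - 1))

/-- `ν` is the product measure on `ℤ → ℝ` with all marginals `m`
(characterized through its finite-dimensional distributions). -/
def IsProductLaw (m : Measure ℝ) (ν : Measure (ℤ → ℝ)) : Prop :=
  IsProbabilityMeasure ν ∧
    ∀ I : Finset ℤ, ν.map (fun w (i : I) => w (i : ℤ)) = Measure.pi fun _ : I => m

/-- The law on `ℤ → ℝ` which is iid `m` on the finite window `I` and `0` elsewhere. -/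
def finExtLaw (I : Finset ℤ) (m : Measure ℝ) : Measure (ℤ → ℝ) :=
  (Measure.pi fun _ : I => m).map fun f i => if h : i ∈ I then f ⟨i, h⟩ else 0

/-- Law of the pair (fractions, weights) driving one step of the width-`N` silo. -/
def siloDriveLaw (N : ℕ) (νV : Measure ℝ) : Measure ((ℤ → ℝ) × (ℤ → ℝ)) :=
  (finExtLaw (Finset.Icc 0 ((N : ℤ) + 1)) unif01).prod (finExtLaw (Finset.Icc 1 (N : ℤ)) νV)

/-- `μ` is carried by the state space `[0,∞)^{Λ^N}`. -/
def SiloSupported (N : ℕ) (μ : Measure (ℤ → ℝ)) : Prop :=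
  μ {w | ∀ i : ℤ, 0 ≤ w i ∧ (¬(1 ≤ i ∧ i ≤ (N : ℤ)) → w i = 0)} = 1

/-- Hypotheses on the common law of the grain weights `V_t(i)`: a probability measure on
`[0,∞)` with mean `1` and finite variance. -/
def IsVLaw (νV : Measure ℝ) : Prop :=
  IsProbabilityMeasure νV ∧ νV {x | x < 0} = 0 ∧ (∫ x, x ∂νV) = 1 ∧
    Integrable (fun x => x ^ 2) νV

/-- `μ` is an invariant probability measure for the width-`N` silo process. -/
def IsSiloInvariant (N : ℕ) (νV : Measure ℝ) (μ : Measure (ℤ → ℝ)) : Prop :=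
  IsProbabilityMeasure μ ∧ SiloSupported N μ ∧
    (μ.prod (siloDriveLaw N νV)).map (fun p => siloStep N p.2.1 p.2.2 p.1) = μ

/-- The law of the silo process at time `t`, started from the distribution `μ0`. -/
def siloChainLaw (N : ℕ) (νV : Measure ℝ) (μ0 : Measure (ℤ → ℝ)) : ℕ → Measure (ℤ → ℝ)
  | 0 => μ0
  | t + 1 =>
      ((siloChainLaw N νV μ0 t).prod (siloDriveLaw N νV)).map
        fun p => siloStep N p.2.1 p.2.2 p.1

/-- One step of the infinite silo model with fractions `u`. -/
def ismStep (u η : ℤ → ℝ) : ℤ → ℝ :=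
  fun i => η (i - 1) * u (i - 1) + η (i + 1) * (1 - u (i + 1))

/-- `ν` is invariant for the infinite silo model. -/
def IsISMInvariant (ν : Measure (ℤ → ℝ)) : Prop :=
  ∀ κ : Measure (ℤ → ℝ), IsProductLaw unif01 κ →
    ((ν.prod κ).map fun p => ismStep p.2 p.1) = ν

/-- The shift `τ_1` on configurations. -/
def shift1 (η : ℤ → ℝ) : ℤ → ℝ := fun i => η (i - 1)

/-- `ν` plays the role of `ν_ρ`: the product of Gamma(2, 2/ρ) laws for `ρ ≠ 0`,
and the point mass at the zero configuration for `ρ = 0`. -/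
def IsNuRho (ρ : ℝ) (ν : Measure (ℤ → ℝ)) : Prop :=
  (ρ = 0 → ν = Measure.dirac fun _ => 0) ∧
    (ρ ≠ 0 → IsProductLaw (gammaMeasure 2 (2 / ρ)) ν)


/-- The weight `i ↦ i (N + 1 - i)`, strictly superharmonic for the walk killed outside the box. -/
def boxWeight (N : ℕ) (i : ℤ) : ℝ := i * (N + 1 - i)

/-- Weighted `ℓ¹` distance between the restrictions of two configurations to the box. -/
def boxDist (N : ℕ) (w w' : ℤ → ℝ) : ℝ :=
  ∑ i ∈ Finset.Icc (1 : ℤ) N, boxWeight N i * |w i - w' i|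

/-- Contraction rate of the silo dynamics for `boxDist`. -/
def boxRate (N : ℕ) : ℝ := 1 - 1 / ((N : ℝ) + 1) ^ 2

lemma boxWeight_ge_one {N : ℕ} {i : ℤ} (hi : i ∈ Finset.Icc (1 : ℤ) N) : 1 ≤ boxWeight N i := by
  obtain ⟨h1, h2⟩ := Finset.mem_Icc.1 hi
  have h1 : (1 : ℝ) ≤ i := by exact_mod_cast h1
  have h2 : (i : ℝ) ≤ N := by exact_mod_cast h2
  unfold boxWeight
  nlinarith

lemma boxWeight_average_le {N : ℕ} {i : ℤ} (hi : i ∈ Finset.Icc (1 : ℤ) N) :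
    (boxWeight N (i - 1) + boxWeight N (i + 1)) / 2 ≤ boxRate N * boxWeight N i := by
  obtain ⟨h1, h2⟩ := Finset.mem_Icc.1 hi
  have h1 : (1 : ℝ) ≤ i := by exact_mod_cast h1
  have h2 : (i : ℝ) ≤ N := by exact_mod_cast h2
  have hle : boxWeight N i / ((N : ℝ) + 1) ^ 2 ≤ 1 := by
    rw [div_le_one (by positivity)]
    unfold boxWeight
    nlinarith
  have heq : (boxWeight N (i - 1) + boxWeight N (i + 1)) / 2 = boxWeight N i - 1 := by
    unfold boxWeight
    push_cast
    ring
  rw [heq, boxRate, sub_mul, one_mul, one_div_mul_eq_div]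
  linarith

lemma boxRate_nonneg (N : ℕ) : 0 ≤ boxRate N := by
  rw [boxRate, sub_nonneg, div_le_one (by positivity)]
  nlinarith [(Nat.cast_nonneg N : (0 : ℝ) ≤ N)]

lemma boxRate_lt_one (N : ℕ) : boxRate N < 1 := by
  rw [boxRate, sub_lt_self_iff]
  positivity

lemma abs_sub_le_boxDist {N : ℕ} (w w' : ℤ → ℝ) {i : ℤ} (hi : i ∈ Finset.Icc (1 : ℤ) N) :
    |w i - w' i| ≤ boxDist N w w' := by
  have hnn : ∀ j ∈ Finset.Icc (1 : ℤ) N, 0 ≤ boxWeight N j * |w j - w' j| := fun j hj =>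
    mul_nonneg (zero_le_one.trans (boxWeight_ge_one hj)) (abs_nonneg _)
  exact (le_mul_of_one_le_left (abs_nonneg _) (boxWeight_ge_one hi)).trans
    (Finset.single_le_sum hnn hi)

lemma boxDist_nonneg (N : ℕ) (w w' : ℤ → ℝ) : 0 ≤ boxDist N w w' :=
  Finset.sum_nonneg fun _ hj =>
    mul_nonneg (zero_le_one.trans (boxWeight_ge_one hj)) (abs_nonneg _)

lemma sum_Icc_shift (N : ℕ) (F : ℤ → ℝ) (h1 : F 1 = 0) (hN : F (N + 1) = 0) :
    ∑ i ∈ Finset.Icc (1 : ℤ) N, F (i + 1) = ∑ i ∈ Finset.Icc (1 : ℤ) N, F i := by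
  have hmap : ∑ i ∈ Finset.Icc (1 : ℤ) N, F (i + 1) =
      ∑ i ∈ Finset.Icc (2 : ℤ) (N + 1), F i :=
    Finset.sum_bij (fun i _ => i + 1) (fun i hi => by simp at hi ⊢; omega)
      (fun i _ j _ h => by simpa using h)
      (fun j hj => ⟨j - 1, by simp at hj ⊢; omega, by simp⟩) (fun _ _ => rfl)
  rw [hmap, Finset.sum_subset (s₂ := Finset.Icc (1 : ℤ) (N + 1)) (fun i hi => by
      simp at hi ⊢; omega), ← Finset.sum_subset (s₁ := Finset.Icc (1 : ℤ) N) (fun i hi => by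
      simp at hi ⊢; omega)]
  · intro i hi hi'
    obtain rfl : i = N + 1 := by simp at hi hi'; omega
    exact hN
  · intro i hi hi'
    obtain rfl : i = 1 := by simp at hi hi'; omega
    exact h1

lemma boxDist_siloStep_le (N : ℕ) {u : ℤ → ℝ} (v w w' : ℤ → ℝ)
    (hu : ∀ i ∈ Finset.Icc (1 : ℤ) N, u i ∈ Set.Icc (0 : ℝ) 1) :
    boxDist N (siloStep N u v w) (siloStep N u v w') ≤
      ∑ i ∈ Finset.Icc (1 : ℤ) N,
        |w i - w' i| * (boxWeight N (i - 1) * u i + boxWeight N (i + 1) * (1 - u i)) := by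
  set g : ℤ → ℝ := fun i => |trunc N w i - trunc N w' i| with hg
  have hg0 : g 0 = 0 := by simp [hg, trunc]
  have hgN : g (N + 1) = 0 := by simp [hg, trunc]
  have hgi : ∀ i ∈ Finset.Icc (1 : ℤ) N, g i = |w i - w' i| := fun i hi => by
    simp [hg, trunc, Finset.mem_Icc.1 hi]
  have hup : ∀ i, 1 ≤ i → i ≤ (N : ℤ) + 1 →
      |(trunc N w i - trunc N w' i) * u i| ≤ g i * u i := fun i h1 h2 => by
    rcases h2.lt_or_eq with h | rfl
    · rw [abs_mul, abs_of_nonneg (hu i (by simp; omega)).1]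
    · simp [hg, trunc]
  have hdown : ∀ i, 0 ≤ i → i ≤ (N : ℤ) →
      |(trunc N w i - trunc N w' i) * (1 - u i)| ≤ g i * (1 - u i) := fun i h1 h2 => by
    rcases h1.lt_or_eq with h | rfl
    · rw [abs_mul, abs_of_nonneg (sub_nonneg.2 (hu i (by simp; omega)).2)]
    · simp [hg, trunc]
  have hstep : ∀ i ∈ Finset.Icc (1 : ℤ) N,
      boxWeight N i * |siloStep N u v w i - siloStep N u v w' i| ≤
        boxWeight N i * (g (i + 1) * u (i + 1)) +
          boxWeight N i * (g (i - 1) * (1 - u (i - 1))) := fun i hi => by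
    rw [← mul_add]
    refine mul_le_mul_of_nonneg_left ?_ (zero_le_one.trans (boxWeight_ge_one hi))
    obtain ⟨h1, h2⟩ := Finset.mem_Icc.1 hi
    have heq : siloStep N u v w i - siloStep N u v w' i =
        (trunc N w (i + 1) - trunc N w' (i + 1)) * u (i + 1) +
          (trunc N w (i - 1) - trunc N w' (i - 1)) * (1 - u (i - 1)) := by
      have e : ∀ z, siloStep N u v z i =
          v i + trunc N z (i + 1) * u (i + 1) + trunc N z (i - 1) * (1 - u (i - 1)) :=
        fun z => if_pos ⟨h1, h2⟩
      rw [e, e]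
      ring
    rw [heq]
    exact (abs_add_le _ _).trans (add_le_add (hup _ (by omega) (by omega))
      (hdown _ (by omega) (by omega)))
  refine (Finset.sum_le_sum hstep).trans_eq ?_
  have e1 := sum_Icc_shift N (fun i => boxWeight N (i - 1) * (g i * u i))
    (by simp [boxWeight]) (by simp [hgN])
  have e2 := sum_Icc_shift N (fun i => boxWeight N i * (g (i - 1) * (1 - u (i - 1))))
    (by simp [hg0]) (by simp [boxWeight])
  simp only [add_sub_cancel_right] at e1 e2
  rw [Finset.sum_add_distrib, e1, ← e2, ← Finset.sum_add_distrib]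
  refine Finset.sum_congr rfl fun i hi => ?_
  rw [hgi i hi]
  ring

instance : IsProbabilityMeasure unif01 := ⟨by simp [unif01]⟩

lemma measurable_finExt (I : Finset ℤ) :
    Measurable fun (f : I → ℝ) (i : ℤ) => if h : i ∈ I then f ⟨i, h⟩ else 0 := by
  refine measurable_pi_lambda _ fun i => ?_
  by_cases h : i ∈ I
  · simpa [h] using measurable_pi_apply _
  · simp [h]

instance (I : Finset ℤ) (m : Measure ℝ) [IsProbabilityMeasure m] :
    IsProbabilityMeasure (finExtLaw I m) :=
  Measure.isProbabilityMeasure_map (measurable_finExt I).aemeasurable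

instance (N : ℕ) (m : Measure ℝ) [IsProbabilityMeasure m] :
    IsProbabilityMeasure (siloDriveLaw N m) := by
  unfold siloDriveLaw
  infer_instance

lemma measurePreserving_eval_finExtLaw {I : Finset ℤ} (m : Measure ℝ) [IsProbabilityMeasure m]
    {i : ℤ} (hi : i ∈ I) : MeasurePreserving (fun w : ℤ → ℝ => w i) (finExtLaw I m) m := by
  refine ⟨measurable_pi_apply i, ?_⟩
  rw [finExtLaw, Measure.map_map (measurable_pi_apply i) (measurable_finExt I)]
  convert (measurePreserving_eval (fun _ : I => m) ⟨i, hi⟩).map_eq using 2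
  ext f
  simp [hi]

lemma measurePreserving_fraction {N : ℕ} (m : Measure ℝ) [IsProbabilityMeasure m] {i : ℤ}
    (hi : i ∈ Finset.Icc (1 : ℤ) N) :
    MeasurePreserving (fun p : (ℤ → ℝ) × (ℤ → ℝ) => p.1 i) (siloDriveLaw N m) unif01 :=
  (measurePreserving_eval_finExtLaw unif01 (by simp at hi ⊢; omega)).comp
    measurePreserving_fst

lemma integrable_id_unif01 : Integrable (fun x => x) unif01 :=
  (continuous_id.integrableOn_Icc : IntegrableOn (fun x : ℝ => x) (Set.Icc 0 1) volume)

lemma integral_id_unif01 : ∫ x, x ∂unif01 = 1 / 2 := by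
  rw [unif01, integral_Icc_eq_integral_Ioc, ← intervalIntegral.integral_of_le zero_le_one,
    integral_id]
  norm_num

lemma integrable_fraction {N : ℕ} (m : Measure ℝ) [IsProbabilityMeasure m] {i : ℤ}
    (hi : i ∈ Finset.Icc (1 : ℤ) N) :
    Integrable (fun p : (ℤ → ℝ) × (ℤ → ℝ) => p.1 i) (siloDriveLaw N m) :=
  (measurePreserving_fraction m hi).integrable_comp_of_integrable integrable_id_unif01

lemma integral_fraction {N : ℕ} (m : Measure ℝ) [IsProbabilityMeasure m] {i : ℤ}
    (hi : i ∈ Finset.Icc (1 : ℤ) N) :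
    ∫ p, p.1 i ∂siloDriveLaw N m = 1 / 2 := by
  have h := measurePreserving_fraction m hi
  rw [← integral_id_unif01, ← h.map_eq,
    integral_map h.measurable.aemeasurable (by fun_prop)]

lemma ae_fraction_mem (N : ℕ) (m : Measure ℝ) [IsProbabilityMeasure m] :
    ∀ᵐ p ∂siloDriveLaw N m, ∀ i ∈ Finset.Icc (1 : ℤ) N, p.1 i ∈ Set.Icc (0 : ℝ) 1 := by
  rw [Finset.eventually_all]
  intro i hi
  have h : ∀ᵐ x ∂unif01, x ∈ Set.Icc (0 : ℝ) 1 := ae_restrict_mem measurableSet_Icc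
  exact (measurePreserving_fraction m hi).quasiMeasurePreserving.ae h

lemma measurable_siloStep (N : ℕ) :
    Measurable fun p : (ℤ → ℝ) × (ℤ → ℝ) × (ℤ → ℝ) => siloStep N p.2.1 p.2.2 p.1 := by
  have ht : ∀ i, Measurable fun w : ℤ → ℝ => trunc N w i := fun i => by
    unfold trunc
    split_ifs <;> fun_prop
  have ht' : ∀ i, Measurable fun p : (ℤ → ℝ) × (ℤ → ℝ) × (ℤ → ℝ) => trunc N p.1 i :=
    fun i => (ht i).comp measurable_fst
  refine measurable_pi_lambda _ fun i => (ht i).comp (measurable_pi_lambda _ fun j => ?_)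
  have h1 := ht' (j + 1)
  have h2 := ht' (j - 1)
  fun_prop

/-- Measurable test functions bounded by `1` and `C`-Lipschitz for `boxDist`. -/
structure IsBoxTest (N : ℕ) (C : ℝ) (f : (ℤ → ℝ) → ℂ) : Prop where
  measurable : Measurable f
  norm_le_one : ∀ w, ‖f w‖ ≤ 1
  lipschitz : ∀ w w', ‖f w - f w'‖ ≤ C * boxDist N w w'

/-- The transition operator of the silo process. -/
def siloAverage (N : ℕ) (m : Measure ℝ) (f : (ℤ → ℝ) → ℂ) (w : ℤ → ℝ) : ℂ :=
  ∫ p, f (siloStep N p.1 p.2 w) ∂siloDriveLaw N m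

lemma IsBoxTest.integrable_comp {N : ℕ} {C : ℝ} {f : (ℤ → ℝ) → ℂ} (hf : IsBoxTest N C f)
    {Ω : Type*} [MeasurableSpace Ω] {P : Measure Ω} [IsFiniteMeasure P] {X : Ω → ℤ → ℝ}
    (hX : Measurable X) : Integrable (fun ω => f (X ω)) P :=
  Integrable.of_bound (hf.measurable.comp hX).aestronglyMeasurable 1
    (Eventually.of_forall fun _ => hf.norm_le_one _)

lemma measurable_siloStep_drive (N : ℕ) (w : ℤ → ℝ) :
    Measurable fun p : (ℤ → ℝ) × (ℤ → ℝ) => siloStep N p.1 p.2 w :=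
  (measurable_siloStep N).comp (measurable_const.prodMk measurable_id)

lemma IsBoxTest.average {N : ℕ} (m : Measure ℝ) [IsProbabilityMeasure m] {C : ℝ}
    (hC : 0 ≤ C) {f : (ℤ → ℝ) → ℂ} (hf : IsBoxTest N C f) :
    IsBoxTest N (C * boxRate N) (siloAverage N m f) where
  measurable := ((hf.measurable.comp
    (measurable_siloStep N)).stronglyMeasurable.integral_prod_right').measurable
  norm_le_one w := by
    simpa [siloAverage] using norm_integral_le_of_norm_le_const (μ := siloDriveLaw N m)
      (Eventually.of_forall fun p => hf.norm_le_one (siloStep N p.1 p.2 w))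
  lipschitz w w' := by
    have hInt : ∀ i ∈ Finset.Icc (1 : ℤ) N, Integrable (fun p : (ℤ → ℝ) × (ℤ → ℝ) =>
        |w i - w' i| * (boxWeight N (i - 1) * p.1 i + boxWeight N (i + 1) * (1 - p.1 i)))
        (siloDriveLaw N m) := fun i hi =>
      ((integrable_fraction m hi).const_mul _ |>.add
        (((integrable_const 1).sub (integrable_fraction m hi)).const_mul _)).const_mul _
    have hval : ∀ i ∈ Finset.Icc (1 : ℤ) N, ∫ p, |w i - w' i| * (boxWeight N (i - 1) * p.1 i +
        boxWeight N (i + 1) * (1 - p.1 i)) ∂siloDriveLaw N m ≤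
        boxRate N * (boxWeight N i * |w i - w' i|) := fun i hi => by
      have hI := integrable_fraction m hi
      have hI' : Integrable (fun p : (ℤ → ℝ) × (ℤ → ℝ) => 1 - p.1 i) (siloDriveLaw N m) :=
        (integrable_const 1).sub hI
      rw [integral_const_mul, integral_add (hI.const_mul _) (hI'.const_mul _),
        integral_const_mul, integral_const_mul, integral_sub (integrable_const 1) hI, integral_fraction m hi]
      simp only [integral_const, probReal_univ, smul_eq_mul]
      nlinarith [mul_le_mul_of_nonneg_right (boxWeight_average_le hi) (abs_nonneg (w i - w' i))]
    rw [siloAverage, siloAverage, ← integral_sub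
      (hf.integrable_comp (measurable_siloStep_drive N w))
      (hf.integrable_comp (measurable_siloStep_drive N w'))]
    calc _ ≤ ∫ p, C * ∑ i ∈ Finset.Icc (1 : ℤ) N, |w i - w' i| *
          (boxWeight N (i - 1) * p.1 i + boxWeight N (i + 1) * (1 - p.1 i)) ∂siloDriveLaw N m :=
          norm_integral_le_of_norm_le ((integrable_finsetSum _ hInt).const_mul C) <| by
            filter_upwards [ae_fraction_mem N m] with p hp
            exact (hf.lipschitz _ _).trans
              (mul_le_mul_of_nonneg_left (boxDist_siloStep_le N p.2 w w' hp) hC)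
      _ ≤ C * (boxRate N * boxDist N w w') := by
          rw [integral_const_mul, integral_finsetSum _ hInt, boxDist,
            Finset.mul_sum (Finset.Icc (1 : ℤ) N) _ (boxRate N)]
          exact mul_le_mul_of_nonneg_left (Finset.sum_le_sum hval) hC
      _ = C * boxRate N * boxDist N w w' := by ring

lemma IsBoxTest.integral_average {N : ℕ} {m : Measure ℝ} [IsProbabilityMeasure m] {C : ℝ}
    {f : (ℤ → ℝ) → ℂ} (hf : IsBoxTest N C f) {μ : Measure (ℤ → ℝ)}
    (hμ : IsSiloInvariant N m μ) : ∫ w, siloAverage N m f w ∂μ = ∫ w, f w ∂μ := by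
  have := hμ.1
  conv_rhs => rw [← hμ.2.2]
  rw [integral_map (measurable_siloStep N).aemeasurable hf.measurable.aestronglyMeasurable,
    integral_prod _ (hf.integrable_comp (measurable_siloStep N))]
  rfl

lemma IsBoxTest.integral_eq {N : ℕ} {m : Measure ℝ} [IsProbabilityMeasure m] {C : ℝ}
    (hC : 0 ≤ C) {f : (ℤ → ℝ) → ℂ} (hf : IsBoxTest N C f) {μ ν : Measure (ℤ → ℝ)}
    (hμ : IsSiloInvariant N m μ) (hν : IsSiloInvariant N m ν) :
    ∫ w, f w ∂μ = ∫ w, f w ∂ν := by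
  have := hμ.1
  have := hν.1
  set F : ℕ → (ℤ → ℝ) → ℂ := fun n => (siloAverage N m)^[n] f with hF
  have hsucc : ∀ n, F (n + 1) = siloAverage N m (F n) := fun n =>
    Function.iterate_succ_apply' _ _ _
  have htest : ∀ n, IsBoxTest N (C * boxRate N ^ n) (F n) := fun n => by
    induction n with
    | zero => simpa [hF] using hf
    | succ n ih =>
      rw [hsucc, pow_succ, ← mul_assoc]
      exact ih.average m (mul_nonneg hC (pow_nonneg (boxRate_nonneg N) n))
  have hconst : ∀ {κ}, IsSiloInvariant N m κ → ∀ n, ∫ w, F n w ∂κ = ∫ w, f w ∂κ :=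
    fun hκ n => by
      induction n with
      | zero => rfl
      | succ n ih => rw [hsucc, (htest n).integral_average hκ, ih]
  have hdiff : ∀ n, ∫ p, (F n p.1 - F n p.2) ∂μ.prod ν = ∫ w, f w ∂μ - ∫ w, f w ∂ν :=
    fun n => by
      rw [integral_sub ((htest n).integrable_comp measurable_fst)
        ((htest n).integrable_comp measurable_snd), integral_fun_fst, integral_fun_snd,
        hconst hμ, hconst hν]
      simp
  have hlim : Tendsto (fun n => ∫ p, (F n p.1 - F n p.2) ∂μ.prod ν) atTop
      (nhds (∫ _, (0 : ℂ) ∂μ.prod ν)) := by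
    refine tendsto_integral_of_dominated_convergence (fun _ => 2) (fun n =>
      (((htest n).measurable.comp measurable_fst).sub
        ((htest n).measurable.comp measurable_snd)).aestronglyMeasurable)
      (integrable_const 2) (fun n => Eventually.of_forall fun p => ?_)
      (Eventually.of_forall fun p => ?_)
    · exact (norm_sub_le _ _).trans
        (by linarith [(htest n).norm_le_one p.1, (htest n).norm_le_one p.2])
    · refine squeeze_zero_norm (fun n => (htest n).lipschitz p.1 p.2) ?_
      simpa using ((tendsto_pow_atTop_nhds_zero_of_lt_one (boxRate_nonneg N)
        (boxRate_lt_one N)).const_mul C).mul_const (boxDist N p.1 p.2)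
  simp only [hdiff, integral_zero] at hlim
  exact sub_eq_zero.1 (tendsto_nhds_unique tendsto_const_nhds hlim)

lemma SiloSupported.map_trunc {N : ℕ} {μ : Measure (ℤ → ℝ)} [IsProbabilityMeasure μ]
    (hμ : SiloSupported N μ) :
    (μ.map (Finset.Icc (1 : ℤ) N).restrict).map
      (fun f i => if h : i ∈ Finset.Icc (1 : ℤ) N then f ⟨i, h⟩ else 0) = μ := by
  rw [Measure.map_map (measurable_finExt _) (Finset.measurable_restrict _)]
  conv_rhs => rw [← Measure.map_id (μ := μ)]
  refine Measure.map_congr ?_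
  have hmeas : MeasurableSet
      {w : ℤ → ℝ | ∀ i : ℤ, 0 ≤ w i ∧ (¬(1 ≤ i ∧ i ≤ (N : ℤ)) → w i = 0)} := by
    measurability
  filter_upwards [(mem_ae_iff_prob_eq_one hmeas).2 hμ] with w hw
  ext i
  by_cases h : 1 ≤ i ∧ i ≤ (N : ℤ)
  · simp [h]
  · simp [h, (hw i).2 h]

lemma isBoxTest_exp (N : ℕ) (L : StrongDual ℝ (Finset.Icc (1 : ℤ) N → ℝ)) :
    IsBoxTest N ‖L‖ fun w =>
      Complex.exp (L ((Finset.Icc (1 : ℤ) N).restrict w) * Complex.I) where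
  measurable := by
    have := L.measurable.comp
      (Finset.measurable_restrict (X := fun _ : ℤ => ℝ) (Finset.Icc (1 : ℤ) N))
    fun_prop
  norm_le_one w := (Complex.norm_exp_ofReal_mul_I _).le
  lipschitz w w' := by
    set r := (Finset.Icc (1 : ℤ) N).restrict w
    set r' := (Finset.Icc (1 : ℤ) N).restrict w'
    have hsplit : Complex.exp (L r * Complex.I) - Complex.exp (L r' * Complex.I) =
        Complex.exp (L r' * Complex.I) * (Complex.exp (Complex.I * (L r - L r' : ℝ)) - 1) := by
      rw [mul_sub, ← Complex.exp_add]
      push_cast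
      ring_nf
    have hnorm : ‖r - r'‖ ≤ boxDist N w w' :=
      (pi_norm_le_iff_of_nonneg (boxDist_nonneg N w w')).2 fun i =>
        abs_sub_le_boxDist w w' i.2
    rw [hsplit, norm_mul, Complex.norm_exp_ofReal_mul_I, one_mul]
    refine (Real.norm_exp_I_mul_ofReal_sub_one_le).trans ?_
    rw [← map_sub]
    exact (L.le_opNorm _).trans (mul_le_mul_of_nonneg_left hnorm (norm_nonneg L))

/-- The width-`N` silo process has at most one invariant probability measure. -/
theorem silo_invariant_measure_unique (N : ℕ) (hN : 1 ≤ N)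
    (νV : Measure ℝ) (hνV : IsVLaw νV) (μ ν : Measure (ℤ → ℝ))
    (hμ : IsSiloInvariant N νV μ) (hν : IsSiloInvariant N νV ν) :
    μ = ν := by
  have := hνV.1
  have := hμ.1
  have := hν.1
  rw [← hμ.2.1.map_trunc, ← hν.2.1.map_trunc]
  congr 1
  have hmeas : Measurable ((Finset.Icc (1 : ℤ) N).restrict (π := fun _ => ℝ)) :=
    Finset.measurable_restrict _
  have := Measure.isProbabilityMeasure_map (μ := μ) hmeas.aemeasurable
  have := Measure.isProbabilityMeasure_map (μ := ν) hmeas.aemeasurable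
  refine Measure.ext_of_charFunDual (funext fun L => ?_)
  rw [charFunDual_apply, charFunDual_apply, integral_map hmeas.aemeasurable (by fun_prop),
    integral_map hmeas.aemeasurable (by fun_prop)]
  exact (isBoxTest_exp N L).integral_eq (norm_nonneg L) hμ hν
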